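/- arXiv:2506.03568 — 2 statements merged into one kernel-verified Lean document; each statement's English description precedes it below -/
import Mathlib

section
/- In a finite discounted MDP, for any two stationary policies π and π', the difference of expected returns satisfies the performance difference identity: J(π) − J(π') = (1/(1−γ)) · Σ_s d_π(s) Σ_a π(a|s) · A^{π'}(s,a), where A^{π'}(s,a) = Q^{π'}(s,a) − V^{π'}(s) is the advantage of π' and d_π is the normalized discounted state visitation distribution of π. -/
open scoped BigOperators

/-- The state distribution at time `t` induced by starting from `ρ` and following
policy `π` in an MDP with transition function `P`. -/
noncomputable def stateDist {S A : Type*} [Fintype S] [Fintype A]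
    (P : S → A → S → ℝ) (π : S → A → ℝ) (ρ : S → ℝ) : ℕ → S → ℝ
  | 0 => ρ
  | t + 1 => fun s' => ∑ s : S, ∑ a : A, stateDist P π ρ t s * π s a * P s a s'

/-- The normalized discounted state visitation distribution
`d_π(s) = (1-γ) ∑_{t≥0} γ^t Pr(s_t = s)`. -/
noncomputable def dvisit {S A : Type*} [Fintype S] [Fintype A]
    (γ : ℝ) (P : S → A → S → ℝ) (π : S → A → ℝ) (ρ : S → ℝ) (s : S) : ℝ :=
  (1 - γ) * ∑' t : ℕ, γ ^ t * stateDist P π ρ t s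

/-- Pairing the state distribution at time `t + 1` with `f` is pairing the one at time `t` with
the expected value of `f` after one step. -/
theorem sum_stateDist_succ_mul {S A : Type*} [Fintype S] [Fintype A]
    (P : S → A → S → ℝ) (π : S → A → ℝ) (ρ f : S → ℝ) (t : ℕ) :
    ∑ s', stateDist P π ρ (t + 1) s' * f s'
      = ∑ s, stateDist P π ρ t s * ∑ a, π s a * ∑ s', P s a s' * f s' := by
  simp only [stateDist, Finset.sum_mul, Finset.mul_sum]
  rw [Finset.sum_comm]
  refine Finset.sum_congr rfl fun s _ => ?_
  rw [Finset.sum_comm]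
  refine Finset.sum_congr rfl fun a _ => Finset.sum_congr rfl fun s' _ => ?_
  ring

theorem stateDist_nonneg {S A : Type*} [Fintype S] [Fintype A]
    {P : S → A → S → ℝ} {π : S → A → ℝ} {ρ : S → ℝ}
    (hP0 : ∀ s a s', 0 ≤ P s a s') (hρ0 : ∀ s, 0 ≤ ρ s) (hπ0 : ∀ s a, 0 ≤ π s a) (t : ℕ) (s : S) :
    0 ≤ stateDist P π ρ t s := by
  induction t generalizing s with
  | zero => exact hρ0 s
  | succ t ih =>
    exact Finset.sum_nonneg fun x _ => Finset.sum_nonneg fun a _ =>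
      mul_nonneg (mul_nonneg (ih x) (hπ0 x a)) (hP0 x a s)

theorem sum_stateDist {S A : Type*} [Fintype S] [Fintype A]
    {P : S → A → S → ℝ} {π : S → A → ℝ} {ρ : S → ℝ}
    (hP1 : ∀ s a, ∑ s', P s a s' = 1) (hρ1 : ∑ s, ρ s = 1) (hπ1 : ∀ s, ∑ a, π s a = 1) (t : ℕ) :
    ∑ s, stateDist P π ρ t s = 1 := by
  induction t with
  | zero => exact hρ1
  | succ t ih => simpa [hP1, hπ1, ih] using sum_stateDist_succ_mul P π ρ (fun _ => 1) t

theorem summable_pow_mul_stateDist {S A : Type*} [Fintype S] [Fintype A]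
    {P : S → A → S → ℝ} {γ : ℝ} {π : S → A → ℝ} {ρ : S → ℝ} (hγ0 : 0 ≤ γ) (hγ1 : γ < 1)
    (hP0 : ∀ s a s', 0 ≤ P s a s') (hP1 : ∀ s a, ∑ s', P s a s' = 1)
    (hρ0 : ∀ s, 0 ≤ ρ s) (hρ1 : ∑ s, ρ s = 1)
    (hπ0 : ∀ s a, 0 ≤ π s a) (hπ1 : ∀ s, ∑ a, π s a = 1) (s : S) :
    Summable fun t => γ ^ t * stateDist P π ρ t s := by
  have h0 := stateDist_nonneg hP0 hρ0 hπ0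
  refine (summable_geometric_of_lt_one hγ0 hγ1).of_nonneg_of_le
    (fun t => mul_nonneg (pow_nonneg hγ0 t) (h0 t s)) fun t => ?_
  refine mul_le_of_le_one_right (pow_nonneg hγ0 t) ?_
  rw [← sum_stateDist hP1 hρ1 hπ1 t]
  exact Finset.single_le_sum (fun x _ => h0 t x) (Finset.mem_univ s)

/-- **Performance difference identity.**  In a finite discounted MDP, for any two
stationary policies `π` and `π'`,
`J(π) − J(π') = (1/(1−γ)) ∑_s d_π(s) ∑_a π(a|s) A^{π'}(s,a)`. -/
theorem performance_difference_identity
    {S A : Type*} [Fintype S] [Fintype A] [Nonempty S] [Nonempty A]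
    (P : S → A → S → ℝ) (r : S → A → ℝ) (γ : ℝ) (ρ : S → ℝ)
    (hγ0 : 0 ≤ γ) (hγ1 : γ < 1)
    (hP0 : ∀ s a s', 0 ≤ P s a s') (hP1 : ∀ s a, ∑ s', P s a s' = 1)
    (hρ0 : ∀ s, 0 ≤ ρ s) (hρ1 : ∑ s, ρ s = 1)
    (π π' : S → A → ℝ)
    (hπ0 : ∀ s a, 0 ≤ π s a) (hπ1 : ∀ s, ∑ a, π s a = 1)
    (hπ'0 : ∀ s a, 0 ≤ π' s a) (hπ'1 : ∀ s, ∑ a, π' s a = 1)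
    (Qπ Qπ' : S → A → ℝ) (Vπ Vπ' : S → ℝ)
    (hQπ : ∀ s a, Qπ s a = r s a + γ * ∑ s', P s a s' * Vπ s')
    (hVπ : ∀ s, Vπ s = ∑ a, π s a * Qπ s a)
    (hQπ' : ∀ s a, Qπ' s a = r s a + γ * ∑ s', P s a s' * Vπ' s')
    (hVπ' : ∀ s, Vπ' s = ∑ a, π' s a * Qπ' s a) :
    (∑ s, ρ s * Vπ s) - (∑ s, ρ s * Vπ' s)
      = (1 / (1 - γ)) *
        ∑ s, dvisit γ P π ρ s * ∑ a, π s a * (Qπ' s a - Vπ' s) := by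
  have hsum := summable_pow_mul_stateDist hγ0 hγ1 hP0 hP1 hρ0 hρ1 hπ0 hπ1
  have pairing (f : S → ℝ) : HasSum (fun t => γ ^ t * ∑ s, stateDist P π ρ t s * f s)
      (∑ s, (∑' t, γ ^ t * stateDist P π ρ t s) * f s) := by
    simpa only [Finset.mul_sum, mul_assoc] using
      hasSum_sum fun s (_ : s ∈ Finset.univ) => (hsum s).hasSum.mul_right (f s)
  set g : S → ℝ := fun s => ∑ a, π s a * (Qπ' s a - Vπ' s) with hg
  set W : S → ℝ := fun s => Vπ s - Vπ' s with hW
  have bellman (s : S) : g s = W s - γ * ∑ a, π s a * ∑ s', P s a s' * W s' := by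
    have hQ (a : A) : γ * ∑ s', P s a s' * W s' = Qπ s a - Qπ' s a := by
      simp only [hW, hQπ, hQπ', mul_sub, Finset.sum_sub_distrib]
      ring
    have hV : ∑ a, π s a * Vπ' s = Vπ' s := by rw [← Finset.sum_mul, hπ1, one_mul]
    rw [Finset.mul_sum]
    simp only [mul_left_comm γ, hQ]
    simp only [hg, hW, mul_sub, Finset.sum_sub_distrib, hV, hVπ s]
    ring
  have telescope (t : ℕ) : γ ^ t * ∑ s, stateDist P π ρ t s * g s
      = γ ^ t * ∑ s, stateDist P π ρ t s * W s
        - γ ^ (t + 1) * ∑ s, stateDist P π ρ (t + 1) s * W s := by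
    simp only [sum_stateDist_succ_mul, bellman, mul_sub, Finset.sum_sub_distrib,
      mul_left_comm _ γ]
    rw [← Finset.mul_sum]
    ring
  have key : ∑ s, (∑' t, γ ^ t * stateDist P π ρ t s) * g s = ∑ s, ρ s * W s := by
    refine (pairing g).unique ?_
    simp only [telescope]
    simpa [stateDist] using (pairing W).sub ((hasSum_nat_add_iff' 1).2 (pairing W))
  have hne : 1 - γ ≠ 0 := by linarith
  calc (∑ s, ρ s * Vπ s) - (∑ s, ρ s * Vπ' s) = ∑ s, ρ s * W s := by
        simp only [hW, mul_sub, Finset.sum_sub_distrib]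
    _ = ∑ s, (∑' t, γ ^ t * stateDist P π ρ t s) * g s := key.symm
    _ = (1 / (1 - γ)) * ∑ s, dvisit γ P π ρ s * g s := by
        simp only [dvisit, mul_assoc, ← Finset.mul_sum]
        field_simp
end

section
/- In a finite discounted MDP, let π^g be a stationary policy and π^b any stationary policy such that for every state s the expected advantage of π^b with respect to π^g is bounded below by −c, i.e. Σ_a π^b(a|s) Q^{π^g}(s,a) − V^{π^g}(s) ≥ −c for some constant c ≥ 0. Then the expected return of π^b satisfies J(π^b) ≥ J(π^g) − c/(1−γ). -/
open scoped BigOperators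

/-- A weighted average with nonnegative weights summing to one is at most any upper bound of the
averaged function. -/
theorem sum_mul_le_of_forall_le {ι : Type*} [Fintype ι] {w f : ι → ℝ} {M : ℝ}
    (hw0 : ∀ i, 0 ≤ w i) (hw1 : ∑ i, w i = 1) (hf : ∀ i, f i ≤ M) :
    ∑ i, w i * f i ≤ M :=
  calc ∑ i, w i * f i ≤ ∑ i, w i * M :=
        Finset.sum_le_sum fun i _ => mul_le_mul_of_nonneg_left (hf i) (hw0 i)
    _ = M := by rw [← Finset.sum_mul, hw1, one_mul]

/-- **Lower bound on the return from a per-state advantage lower bound.**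
In a finite discounted MDP, if at every state the expected advantage of `π^b`
with respect to `π^g` is at least `−c` with `c ≥ 0`, then
`J(π^b) ≥ J(π^g) − c/(1−γ)`. -/
theorem return_lower_bound_from_advantage
    {S A : Type*} [Fintype S] [Fintype A] [Nonempty S] [Nonempty A]
    (P : S → A → S → ℝ) (r : S → A → ℝ) (γ : ℝ) (ρ : S → ℝ)
    (hγ0 : 0 ≤ γ) (hγ1 : γ < 1)
    (hP0 : ∀ s a s', 0 ≤ P s a s') (hP1 : ∀ s a, ∑ s', P s a s' = 1)
    (hρ0 : ∀ s, 0 ≤ ρ s) (hρ1 : ∑ s, ρ s = 1)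
    (πg πb : S → A → ℝ)
    (hπg0 : ∀ s a, 0 ≤ πg s a) (hπg1 : ∀ s, ∑ a, πg s a = 1)
    (hπb0 : ∀ s a, 0 ≤ πb s a) (hπb1 : ∀ s, ∑ a, πb s a = 1)
    (Qg : S → A → ℝ) (Vg : S → ℝ)
    (hQg : ∀ s a, Qg s a = r s a + γ * ∑ s', P s a s' * Vg s')
    (hVg : ∀ s, Vg s = ∑ a, πg s a * Qg s a)
    (Qb : S → A → ℝ) (Vb : S → ℝ)
    (hQb : ∀ s a, Qb s a = r s a + γ * ∑ s', P s a s' * Vb s')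
    (hVb : ∀ s, Vb s = ∑ a, πb s a * Qb s a)
    (c : ℝ) (hc : 0 ≤ c)
    (hadv : ∀ s, (∑ a, πb s a * Qg s a) - Vg s ≥ -c) :
    (∑ s, ρ s * Vb s) ≥ (∑ s, ρ s * Vg s) - c / (1 - γ) := by
  obtain ⟨s₀, hs₀⟩ := Finite.exists_max fun s => Vg s - Vb s
  have hQ : ∀ s a, Qg s a - Qb s a ≤ γ * (Vg s₀ - Vb s₀) := by
    intro s a
    have h := mul_le_mul_of_nonneg_left (sum_mul_le_of_forall_le (hP0 s a) (hP1 s a) hs₀) hγ0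
    simp only [mul_sub, Finset.sum_sub_distrib] at h
    rw [hQg, hQb]
    linarith
  have hV : Vg s₀ - Vb s₀ ≤ c / (1 - γ) := by
    have h := sum_mul_le_of_forall_le (hπb0 s₀) (hπb1 s₀) (hQ s₀)
    simp only [mul_sub, Finset.sum_sub_distrib] at h
    rw [le_div_iff₀ (by linarith)]
    linarith [hadv s₀, hVb s₀]
  have h := sum_mul_le_of_forall_le hρ0 hρ1 fun s => (hs₀ s).trans hV
  simp only [mul_sub, Finset.sum_sub_distrib] at h
  linarith
end
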